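/- arXiv:2111.03369 — 5 statements merged into one kernel-verified Lean document; each statement's English description precedes it below -/
import Mathlib

section
/- For all integers n ≥ m ≥ 0, the q-Kaplansky number K_q(n,m) equals the generating function for the inversion number over the set 𝒦(m, n−m+1); that is, K_q(n,m) = Σ_{w ∈ 𝒦(m,n−m+1)} q^{inv(w)}. -/
open Polynomial Finset

/-- The Gaussian polynomial `[n m]_q`, as a polynomial in `ℤ[q]`
(it vanishes when `m > n`).  It is defined by the `q`-Pascal recursion
`[n m]_q = [n-1 m-1]_q + q^m [n-1 m]_q`. -/
noncomputable def gauss : ℕ → ℕ → Polynomial ℤ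
  | _, 0 => 1
  | 0, _ + 1 => 0
  | n + 1, m + 1 => gauss n m + X ^ (m + 1) * gauss n (m + 1)

/-- The `q`-Kaplansky number `K_q(n,m) = ((1-q^(n+m))/(1-q^n))·[n m]_q`,
defined as the polynomial `[n-1 m-1]_q + q^m·[n m]_q`. -/
noncomputable def kap (n : ℕ) : ℕ → Polynomial ℤ
  | 0 => 1
  | m + 1 => gauss (n - 1) m + X ^ (m + 1) * gauss n (m + 1)

/-- The number of ones of a (0,1)-sequence. -/
def numOnes {N : ℕ} (w : Fin N → Bool) : ℕ :=
  (Finset.univ.filter fun i => w i = true).card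

/-- The inversion number of a (0,1)-sequence: the number of pairs `(i,j)`
with `i < j`, `w i = 1` and `w j = 0`. -/
def invW {N : ℕ} (w : Fin N → Bool) : ℕ :=
  ((Finset.univ : Finset (Fin N × Fin N)).filter
    fun p => p.1 < p.2 ∧ w p.1 = true ∧ w p.2 = false).card

/-- The major index of a (0,1)-sequence: the sum of the (1-based) positions `i`
with `w_i > w_(i+1)`. -/
def majW {N : ℕ} (w : Fin N → Bool) : ℕ :=
  ∑ i : Fin N,
    if h : (i : ℕ) + 1 < N then
      (if w i = true ∧ w ⟨(i : ℕ) + 1, h⟩ = false then (i : ℕ) + 1 else 0)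
    else 0

theorem aux_numOnes {N : ℕ} (w : Fin N → Bool) :
    numOnes w = ∑ i, if w i = true then 1 else 0 := by
  simp [numOnes]

theorem aux_invW {N : ℕ} (w : Fin N → Bool) :
    invW w = ∑ i, ∑ j, if i < j ∧ w i = true ∧ w j = false then 1 else 0 := by
  rw [invW, Finset.card_filter, Fintype.sum_prod_type]

theorem aux_numOnes_snoc {N : ℕ} (w : Fin N → Bool) (b : Bool) :
    numOnes (Fin.snoc w b : Fin (N + 1) → Bool) = numOnes w + if b = true then 1 else 0 := by
  simp only [aux_numOnes, Fin.sum_univ_castSucc, Fin.snoc_castSucc, Fin.snoc_last]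

theorem aux_invW_snoc {N : ℕ} (w : Fin N → Bool) (b : Bool) :
    invW (Fin.snoc w b : Fin (N + 1) → Bool) = invW w + if b = true then 0 else numOnes w := by
  have h : ∀ i : Fin N, ¬ Fin.last N < i.castSucc := fun i => not_lt.2 (Fin.le_last _)
  simp only [aux_numOnes, aux_invW, Fin.sum_univ_castSucc, Fin.snoc_castSucc, Fin.snoc_last,
    Fin.castSucc_lt_castSucc_iff, Fin.castSucc_lt_last, h, lt_irrefl, false_and, if_false,
    Finset.sum_const_zero, add_zero, true_and, Finset.sum_add_distrib]
  cases b <;> simp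

theorem aux_numOnes_cons {N : ℕ} (w : Fin N → Bool) :
    numOnes (Fin.cons false w : Fin (N + 1) → Bool) = numOnes w := by
  simp only [aux_numOnes, Fin.sum_univ_succ, Fin.cons_zero, Fin.cons_succ]
  simp

theorem aux_invW_cons {N : ℕ} (w : Fin N → Bool) :
    invW (Fin.cons false w : Fin (N + 1) → Bool) = invW w := by
  simp only [aux_invW, Fin.sum_univ_succ, Fin.cons_zero, Fin.cons_succ, Fin.succ_lt_succ_iff]
  simp

theorem aux_sum_snoc {N : ℕ} (f : (Fin (N + 1) → Bool) → Polynomial ℤ) :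
    ∑ w, f w = ∑ w : Fin N → Bool, f (Fin.snoc w true) + ∑ w : Fin N → Bool, f (Fin.snoc w false) := by
  rw [← (Fin.snocEquiv (fun _ : Fin (N + 1) => Bool)).sum_comp, Fintype.sum_prod_type]
  simp [Fin.snocEquiv]

theorem aux_sum_cons {N : ℕ} (f : (Fin (N + 1) → Bool) → Polynomial ℤ) :
    ∑ w, f w = ∑ w : Fin N → Bool, f (Fin.cons true w) + ∑ w : Fin N → Bool, f (Fin.cons false w) := by
  rw [← (Fin.consEquiv (fun _ : Fin (N + 1) => Bool)).sum_comp, Fintype.sum_prod_type]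
  simp [Fin.consEquiv]

theorem aux_snoc_false (n m : ℕ) :
    (∑ w : Fin n → Bool, if numOnes (Fin.snoc w false : Fin (n + 1) → Bool) = m then
      (X : Polynomial ℤ) ^ invW (Fin.snoc w false : Fin (n + 1) → Bool) else 0) =
    X ^ m * ∑ w : Fin n → Bool, if numOnes w = m then (X : Polynomial ℤ) ^ invW w else 0 := by
  rw [Finset.mul_sum]
  refine Finset.sum_congr rfl fun w _ => ?_
  simp only [aux_numOnes_snoc, aux_invW_snoc]
  by_cases h : numOnes w = m
  · simp [h, pow_add, mul_comm]
  · simp [h]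

theorem aux_gauss (n : ℕ) : ∀ m,
    gauss n m = ∑ w : Fin n → Bool, if numOnes w = m then (X : Polynomial ℤ) ^ invW w else 0 := by
  induction n with
  | zero =>
    intro m
    cases m <;> simp [gauss, numOnes, invW]
  | succ n ih =>
    intro m
    rw [aux_sum_snoc, aux_snoc_false, ← ih]
    simp only [aux_numOnes_snoc, aux_invW_snoc]
    cases m with
    | zero => cases n <;> simp [gauss]
    | succ m => simp [gauss, ih m]

/-- For `n ≥ m ≥ 0`, the `q`-Kaplansky number `K_q(n,m)` is the
generating function for the inversion number over the set `𝒦(m, n-m+1)` of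
(0,1)-sequences of length `n+1` with `m` ones and `n-m+1` zeros such that if the
last entry is `1` then the first entry is `0`. -/
theorem kaplansky_eq_sum_inv (n m : ℕ) (hmn : m ≤ n) :
    kap n m =
      ∑ w ∈ (Finset.univ : Finset (Fin (n + 1) → Bool)).filter
          (fun w => numOnes w = m ∧ (w (Fin.last n) = true → w 0 = false)),
        X ^ invW w := by
  rw [Finset.sum_filter, aux_sum_snoc]
  simp only [Fin.snoc_last, Bool.false_eq_true, false_imp_iff, and_true, true_imp_iff]
  rw [aux_snoc_false, ← aux_gauss]
  cases m with
  | zero =>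
    simp only [aux_numOnes_snoc]
    cases n <;> simp [gauss, kap]
  | succ m =>
    obtain ⟨k, rfl⟩ : ∃ k, n = k + 1 := ⟨n - 1, by omega⟩
    have h0 : ∀ w : Fin (k + 1) → Bool,
        (Fin.snoc w true : Fin (k + 1 + 1) → Bool) 0 = w 0 := fun w =>
      Fin.snoc_castSucc (α := fun _ => Bool) true w 0
    simp only [h0, aux_numOnes_snoc, aux_invW_snoc]
    rw [aux_sum_cons]
    simp [aux_numOnes_cons, aux_invW_cons, kap, aux_gauss k m]
end

section
/- For all integers n ≥ m ≥ 0, the q-Kaplansky number K_q(n,m) equals the generating function for the major index over the set 𝒦̄(m, n−m+1); that is, K_q(n,m) = Σ_{w ∈ 𝒦̄(m,n−m+1)} q^{maj(w)}. -/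
open Polynomial Finset

def sn {N : ℕ} (v : Fin N → Bool) (b : Bool) : Fin (N + 1) → Bool :=
  Fin.snoc (α := fun _ => Bool) v b

theorem sum_snoc {N : ℕ} (f : (Fin (N + 1) → Bool) → ℤ[X]) :
    ∑ w, f w = ∑ v : Fin N → Bool, (f (sn v true) + f (sn v false)) := by
  rw [← (Fin.snocEquiv (fun _ : Fin (N + 1) => Bool)).sum_comp, Fintype.sum_prod_type_right]
  simp [Fin.snocEquiv, sn]

theorem sn_castSucc {N : ℕ} (v : Fin N → Bool) (b : Bool) (i : Fin N) :
    sn v b i.castSucc = v i := by simp [sn]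

theorem sn_last {N : ℕ} (v : Fin N → Bool) (b : Bool) :
    sn v b (Fin.last N) = b := by simp [sn]

theorem numOnes_sn {N : ℕ} (v : Fin N → Bool) (b : Bool) :
    numOnes (sn v b) = numOnes v + if b then 1 else 0 := by
  unfold numOnes
  rw [Finset.card_filter, Finset.card_filter, Fin.sum_univ_castSucc]
  simp only [sn_castSucc, sn_last]

theorem majW_sn {N : ℕ} (v : Fin (N + 1) → Bool) (b : Bool) :
    majW (sn v b) = majW v + if v (Fin.last N) = true ∧ b = false then N + 1 else 0 := by
  unfold majW
  rw [Fin.sum_univ_castSucc]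
  simp only [sn_castSucc, Fin.val_last, lt_irrefl, dite_false, add_zero]
  rw [Fin.sum_univ_castSucc, Fin.sum_univ_castSucc]
  simp only [Fin.val_last, Fin.val_castSucc, lt_irrefl, dite_false, add_zero]
  congr 1
  · apply Finset.sum_congr rfl
    intro i _
    have h1 : (i : ℕ) + 1 < N + 1 + 1 := by omega
    have h2 : (i : ℕ) + 1 < N + 1 := by omega
    rw [dif_pos h1, dif_pos h2]
    have := sn_castSucc v b ⟨(i : ℕ) + 1, h2⟩
    simp only [Fin.castSucc_mk] at this
    rw [this]
  · rw [dif_pos (by omega)]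
    have : sn v b ⟨N + 1, by omega⟩ = b := sn_last v b
    rw [this]

theorem majW_zero (v : Fin 0 → Bool) : majW v = 0 := by simp [majW]
theorem numOnes_zero (v : Fin 0 → Bool) : numOnes v = 0 := by simp [numOnes]
theorem majW_one (v : Fin 1 → Bool) : majW v = 0 := by simp [majW]

theorem majW_sn_true {N : ℕ} (v : Fin N → Bool) : majW (sn v true) = majW v := by
  cases N with
  | zero => rw [majW_zero, majW_one]
  | succ N => simp [majW_sn]

def PP {N : ℕ} (w : Fin N → Bool) : Prop :=
  ∀ t : Fin N, w t = false → (∀ j : Fin N, t < j → w j = true) →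
    ((t : ℕ) = 0 ∨ w ⟨(t : ℕ) - 1, lt_of_le_of_lt (Nat.sub_le _ _) t.isLt⟩ = false)

theorem PP_sn_true {N : ℕ} (v : Fin N → Bool) : PP (sn v true) ↔ PP v := by
  have key : ∀ t : Fin N, sn v true ⟨(t.castSucc : ℕ) - 1,
      lt_of_le_of_lt (Nat.sub_le _ _) t.castSucc.isLt⟩ =
      v ⟨(t : ℕ) - 1, lt_of_le_of_lt (Nat.sub_le _ _) t.isLt⟩ := fun t =>
    sn_castSucc v true ⟨(t : ℕ) - 1, lt_of_le_of_lt (Nat.sub_le _ _) t.isLt⟩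
  unfold PP
  rw [Fin.forall_fin_succ']
  simp only [key]
  simp only [sn_last, sn_castSucc, Fin.forall_fin_succ', Fin.castSucc_lt_castSucc_iff,
    Fin.val_castSucc]
  simp

theorem PP_sn_false {N : ℕ} (v : Fin (N + 1) → Bool) :
    PP (sn v false) ↔ v (Fin.last N) = false := by
  have key : sn v false ⟨N, by omega⟩ = v (Fin.last N) := sn_castSucc v false (Fin.last N)
  constructor
  · intro h
    have := h (Fin.last _) (sn_last _ _) (fun j hj => absurd (Fin.le_last j) (not_le.2 hj))
    simp only [Fin.val_last, Nat.add_sub_cancel, key] at this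
    simpa using this
  · intro h t ht hj
    have : t = Fin.last _ := by
      by_contra hne
      have := hj (Fin.last _) (Fin.lt_last_iff_ne_last.2 hne)
      rw [sn_last] at this
      cases this
    subst this
    right
    simp only [Fin.val_last, Nat.add_sub_cancel, key, h]

noncomputable def AA (N m : ℕ) : ℤ[X] :=
  ∑ w : Fin N → Bool, if numOnes w = m then X ^ majW w else 0
noncomputable def ZZ (N m : ℕ) : ℤ[X] :=
  ∑ w : Fin N → Bool, if numOnes w = m then X ^ majW (sn w false) else 0
noncomputable instance {N : ℕ} (w : Fin N → Bool) : Decidable (PP w) := Classical.dec _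
noncomputable def BB (N m : ℕ) : ℤ[X] :=
  ∑ w : Fin N → Bool, if numOnes w = m ∧ PP w then X ^ majW w else 0

theorem AA_succ (N m : ℕ) : AA (N + 1) (m + 1) = AA N m + ZZ N (m + 1) := by
  unfold AA ZZ
  rw [sum_snoc, Finset.sum_add_distrib]
  simp [numOnes_sn, majW_sn_true]
theorem AA_succ_zero (N : ℕ) : AA (N + 1) 0 = ZZ N 0 := by
  unfold AA ZZ
  rw [sum_snoc, Finset.sum_add_distrib]
  simp [numOnes_sn, majW_sn_true]
theorem ZZ_succ (N m : ℕ) : ZZ (N + 1) (m + 1) = ZZ N (m + 1) + X ^ (N + 1) * AA N m := by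
  unfold AA ZZ
  rw [sum_snoc, Finset.sum_add_distrib, add_comm, Finset.mul_sum]
  simp [numOnes_sn, majW_sn (N := N), sn_last, majW_sn_true, pow_add, mul_comm]
theorem ZZ_succ_zero (N : ℕ) : ZZ (N + 1) 0 = ZZ N 0 := by
  unfold ZZ
  rw [sum_snoc, Finset.sum_add_distrib]
  simp [numOnes_sn, majW_sn (N := N), sn_last, majW_sn_true]
theorem BB_succ (N m : ℕ) : BB (N + 2) (m + 1) = BB (N + 1) m + ZZ N (m + 1) := by
  unfold BB ZZ
  rw [sum_snoc, Finset.sum_add_distrib]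
  congr 1
  · simp [numOnes_sn, majW_sn_true, PP_sn_true, sn_last]
  · rw [sum_snoc, Finset.sum_add_distrib]
    simp [numOnes_sn, majW_sn (N := N), PP_sn_false, sn_last]
theorem BB_succ_zero (N : ℕ) : BB (N + 2) 0 = ZZ N 0 := by
  unfold BB ZZ
  rw [sum_snoc, Finset.sum_add_distrib, sum_snoc, Finset.sum_add_distrib,
    sum_snoc, Finset.sum_add_distrib]
  simp [numOnes_sn, majW_sn (N := N), PP_sn_false, sn_last]

theorem gauss_zero (n : ℕ) : gauss n 0 = 1 := by cases n <;> simp [gauss]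

theorem gauss_rel (N : ℕ) : ∀ m : ℕ, ((X : ℤ[X]) ^ m - X ^ N) * gauss N m =
    X ^ m * (1 - X ^ (m + 1)) * gauss N (m + 1) := by
  induction N with
  | zero => intro m; cases m <;> simp [gauss]
  | succ N ih =>
    intro m
    cases m with
    | zero =>
      have := ih 0
      simp only [gauss, gauss_zero] at this ⊢
      linear_combination X * this
    | succ m =>
      have h1 := ih m
      have h2 := ih (m + 1)
      simp only [gauss] at h1 h2 ⊢
      linear_combination X * h1 + X ^ (m + 2) * h2

theorem AZ (N : ℕ) : ∀ m, AA N m = gauss N m ∧ ZZ N m = X ^ m * gauss N m := by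
  induction N with
  | zero =>
    intro m
    cases m <;> simp [AA, ZZ, gauss, numOnes_zero, majW_zero, majW_one]
  | succ N ih =>
    intro m
    cases m with
    | zero =>
      rw [AA_succ_zero, ZZ_succ_zero, (ih 0).2]
      simp [gauss_zero]
    | succ m =>
      rw [AA_succ, ZZ_succ, (ih m).1, (ih (m + 1)).2]
      refine ⟨by simp [gauss], ?_⟩
      have := gauss_rel N m
      simp only [gauss]
      linear_combination (-X) * this

theorem BB_eq (N : ℕ) : ∀ m, m ≤ N → BB (N + 1) m = gauss N m := by
  induction N with
  | zero =>
    intro m hm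
    obtain rfl : m = 0 := by omega
    unfold BB
    rw [sum_snoc]
    have : ∀ x : Fin 0 → Bool, PP (sn x false) := by
      intro x t _ _
      left; omega
    simp [numOnes_sn, numOnes_zero, majW_one, gauss_zero, this]
  | succ N ih =>
    intro m hm
    cases m with
    | zero => rw [BB_succ_zero, (AZ N 0).2]; simp [gauss_zero]
    | succ m => rw [BB_succ, (AZ N _).2, ih m (by omega)]; simp [gauss]

/-- For `n ≥ m ≥ 0`, the `q`-Kaplansky number `K_q(n,m)` is the
generating function for the major index over the set `𝒦̄(m, n-m+1)` of
(0,1)-sequences of length `n+1` with `m` ones and `n-m+1` zeros such that if the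
last entry is `1` and `t` is the (1-based) position of the last zero, then
`t = 1` or `w_(t-1) = 0`.  (Below positions are 0-based, so the condition reads:
for the maximal position `t` with `w t = 0`, either `t = 0` or `w (t-1) = 0`.) -/
theorem kaplansky_eq_sum_maj (n m : ℕ) (hmn : m ≤ n) :
    kap n m =
      ∑ w ∈ (Finset.univ : Finset (Fin (n + 1) → Bool)).filter
          (fun w => numOnes w = m ∧
            (w (Fin.last n) = true →
              ∀ t : Fin (n + 1), w t = false →
                (∀ j : Fin (n + 1), t < j → w j = true) →
                  ((t : ℕ) = 0 ∨
                    w ⟨(t : ℕ) - 1, lt_of_le_of_lt (Nat.sub_le _ _) t.isLt⟩ = false))),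
        X ^ majW w := by
  suffices hgoal : kap n m = ∑ w ∈ (Finset.univ : Finset (Fin (n + 1) → Bool)).filter
    (fun w => numOnes w = m ∧ (w (Fin.last n) = true → PP w)), X ^ majW w by
    rw [hgoal]
    apply Finset.sum_congr _ (fun _ _ => rfl)
    ext w
    refine Finset.mem_filter.trans ?_
    refine Iff.trans ?_ Finset.mem_filter.symm
    rfl
  rw [Finset.sum_filter, sum_snoc, Finset.sum_add_distrib]
  cases m with
  | zero =>
    have h := (AZ n 0).2
    unfold ZZ at h
    simpa [numOnes_sn, sn_last, kap, gauss_zero] using h.symm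
  | succ m =>
    obtain ⟨k, rfl⟩ : ∃ k, n = k + 1 := ⟨n - 1, by omega⟩
    have h := (AZ (k + 1) (m + 1)).2
    have h2 := BB_eq k m (by omega)
    simp only [kap, Nat.add_sub_cancel]
    rw [← h, ← h2]
    unfold ZZ BB
    simp [numOnes_sn, majW_sn_true, PP_sn_true, sn_last]
end

section
/- For every positive integer n, (1−q)·K_q(2n+1, n) = (1−q^{3n+1})·C_n(q) as polynomials in q; equivalently, K_q(2n+1,n) = (1+q+⋯+q^{3n})·C_n(q). -/
open Polynomial Finset

theorem gauss_zero_right (N : ℕ) : gauss N 0 = 1 := by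
  cases N <;> simp [gauss]

theorem gauss_succ (N m : ℕ) :
    gauss (N + 1) (m + 1) = gauss N m + X ^ (m + 1) * gauss N (m + 1) := by
  rw [gauss]

theorem gauss_eq_zero (N : ℕ) : ∀ m, N < m → gauss N m = 0 := by
  induction N with
  | zero =>
    intro m h
    obtain ⟨m, rfl⟩ : ∃ j, m = j + 1 := ⟨m - 1, by omega⟩
    simp [gauss]
  | succ N ih =>
    intro m h
    obtain ⟨m, rfl⟩ : ∃ j, m = j + 1 := ⟨m - 1, by omega⟩
    rw [gauss_succ, ih m (by omega), ih (m + 1) (by omega)]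
    simp

theorem gauss_ratio (N : ℕ) : ∀ m k, m + k = N →
    (1 - X ^ (m + 1)) * gauss N (m + 1) = (1 - X ^ k) * gauss N m := by
  induction N with
  | zero =>
    intro m k h
    obtain rfl : m = 0 := by omega
    obtain rfl : k = 0 := by omega
    simp [gauss]
  | succ N ih =>
    intro m k h
    rcases k with _ | k
    · rw [gauss_eq_zero (N + 1) (m + 1) (by omega)]
      simp
    · have h1 := ih m k (by omega)
      rw [gauss_succ]
      rcases m with _ | m
      · rw [gauss_zero_right] at h1
        rw [gauss_zero_right, gauss_zero_right]
        linear_combination X ^ (0 + 1) * h1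
      · have h2 := ih m (k + 1) (by omega)
        rw [gauss_succ N m]
        linear_combination X ^ (m + 1 + 1) * h1 + h2

/-- For `n ≥ 1`, `(1-q)·K_q(2n+1, n) = (1-q^(3n+1))·C_n(q)`,
equivalently `K_q(2n+1, n) = (1 + q + ⋯ + q^(3n))·C_n(q)`, where the `q`-Catalan
polynomial `C_n(q)` is characterized by `(1-q^(n+1))·C_n(q) = (1-q)·[2n n]_q`. -/
theorem kaplansky_qCatalan (n : ℕ) (hn : 1 ≤ n) (C : Polynomial ℤ)
    (hC : (1 - X ^ (n + 1)) * C = (1 - X) * gauss (2 * n) n) :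
    (1 - X) * kap (2 * n + 1) n = (1 - X ^ (3 * n + 1)) * C ∧
    kap (2 * n + 1) n = (∑ i ∈ Finset.range (3 * n + 1), X ^ i) * C := by
  have hne : ∀ k : ℕ, (1 - X ^ (k + 1) : Polynomial ℤ) ≠ 0 := by
    intro k h
    have := congrArg (Polynomial.eval 0) h
    simp at this
  have main : (1 - X) * kap (2 * n + 1) n = (1 - X ^ (3 * n + 1)) * C := by
    apply mul_left_cancel₀ (hne n)
    obtain ⟨m, rfl⟩ : ∃ j, n = j + 1 := ⟨n - 1, by omega⟩
    have h := gauss_ratio (2 * (m + 1)) m (m + 1 + 1) (by omega)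
    rw [kap, gauss_succ, Nat.add_sub_cancel]
    linear_combination (-(1 - X) * (1 + X ^ (m + 1))) * h - (1 - X ^ (3 * (m + 1) + 1)) * hC
  refine ⟨main, ?_⟩
  have h1 : (1 - X : Polynomial ℤ) ≠ 0 := by simpa using hne 0
  apply mul_left_cancel₀ h1
  rw [main, ← mul_assoc, mul_neg_geom_sum]
end

section
/- For all integers with 1 ≤ m ≤ l < N and M−m ≥ N−l ≥ 1, the polynomial D_q(M,N,m,l) = [M m]_q·[N l]_q − [M m−1]_q·[N l+1]_q has nonnegative coefficients as a polynomial in q. -/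
open Polynomial Finset

/-! Auxiliary material for the proof. -/

/-- Box form of the Gaussian polynomial. -/
noncomputable def boxG (a b : ℕ) : Polynomial ℤ := gauss (a + b) a

theorem gauss_zero_of_lt : ∀ n m : ℕ, n < m → gauss n m = 0
  | _, 0, h => by omega
  | 0, m + 1, _ => by simp [gauss]
  | n + 1, m + 1, h => by
      rw [gauss, gauss_zero_of_lt n m (by omega), gauss_zero_of_lt n (m + 1) (by omega)]
      simp

theorem boxG_zero_left (b : ℕ) : boxG 0 b = 1 := by
  unfold boxG; cases b <;> simp [gauss]

theorem boxG_zero_right (a : ℕ) : boxG a 0 = 1 := by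
  unfold boxG
  induction a with
  | zero => simp [gauss]
  | succ a ih =>
    have h := gauss_zero_of_lt a (a + 1) (by omega)
    simp only [Nat.add_zero] at ih ⊢
    rw [gauss, ih, h]; simp

theorem boxG_rec (a b : ℕ) :
    boxG (a + 1) (b + 1) = boxG a (b + 1) + X ^ (a + 1) * boxG (a + 1) b := by
  unfold boxG
  have e1 : a + 1 + (b + 1) = (a + b + 1) + 1 := by omega
  have e2 : a + (b + 1) = a + b + 1 := by omega
  have e3 : a + 1 + b = a + b + 1 := by omega
  rw [e1, e2, e3, gauss]

theorem boxG_absorb : ∀ s a b : ℕ, a + b = s →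
    (1 - X ^ (a + 1)) * boxG (a + 1) b = (1 - X ^ (b + 1)) * boxG a (b + 1) := by
  intro s
  induction s with
  | zero =>
    intro a b h
    obtain ⟨rfl, rfl⟩ : a = 0 ∧ b = 0 := by omega
    simp [boxG_zero_left, boxG_zero_right]
  | succ s ih =>
    intro a b h
    rcases a with _ | a
    · rcases b with _ | b
      · simp [boxG_zero_left, boxG_zero_right]
      · have h1 := ih 0 b (by omega)
        simp only [boxG_zero_left] at h1 ⊢
        rw [boxG_rec, boxG_zero_left]
        linear_combination (X : Polynomial ℤ) * h1
    · rcases b with _ | b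
      · have h1 := ih a 0 (by omega)
        simp only [boxG_zero_right] at h1 ⊢
        rw [boxG_rec, boxG_zero_right]
        linear_combination h1
      · have h1 := ih a (b + 1) (by omega)
        have h2 := ih (a + 1) b (by omega)
        rw [boxG_rec (a + 1) b, boxG_rec a (b + 1)]
        linear_combination h1 + (X : Polynomial ℤ) ^ (a + 2) * h2

theorem boxG_rec' (a b : ℕ) :
    boxG (a + 1) (b + 1) = boxG (a + 1) b + X ^ (b + 1) * boxG a (b + 1) := by
  rw [boxG_rec]
  linear_combination -boxG_absorb _ a b rfl

/-- `boxG (a-1) (b+1)`, zero for `a = 0`. -/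
noncomputable def boxL : ℕ → ℕ → Polynomial ℤ
  | 0, _ => 0
  | a + 1, b => boxG a (b + 1)

/-- `boxG (c+1) (d-1)`, zero for `d = 0`. -/
noncomputable def boxR : ℕ → ℕ → Polynomial ℤ
  | _, 0 => 0
  | c, d + 1 => boxG (c + 1) d

theorem boxL_rec (a b : ℕ) :
    boxL (a + 1) (b + 1) = boxL a (b + 1) + X ^ a * boxL (a + 1) b := by
  cases a with
  | zero => simp [boxL, boxG_zero_left]
  | succ a => simp only [boxL]; exact boxG_rec _ _

theorem boxL_rec' (a b : ℕ) :
    boxL (a + 1) (b + 1) = boxL (a + 1) b + X ^ (b + 2) * boxL a (b + 1) := by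
  cases a with
  | zero => simp [boxL, boxG_zero_left]
  | succ a => simp only [boxL]; exact boxG_rec' _ _

theorem boxR_rec (c d : ℕ) :
    boxR (c + 1) (d + 1) = boxR c (d + 1) + X ^ (c + 2) * boxR (c + 1) d := by
  cases d with
  | zero => simp [boxR, boxG_zero_right]
  | succ d => simp only [boxR]; exact boxG_rec _ _

theorem boxR_rec' (c d : ℕ) :
    boxR (c + 1) (d + 1) = boxR (c + 1) d + X ^ d * boxR c (d + 1) := by
  cases d with
  | zero => simp [boxR, boxG_zero_right]
  | succ d => simp only [boxR]; exact boxG_rec' _ _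

/-- Coefficientwise nonnegativity. -/
def CoeffNN (p : Polynomial ℤ) : Prop := ∀ i, 0 ≤ p.coeff i

theorem CoeffNN.add {p r : Polynomial ℤ} (hp : CoeffNN p) (hr : CoeffNN r) :
    CoeffNN (p + r) := fun i => by
  rw [coeff_add]; exact add_nonneg (hp i) (hr i)

theorem CoeffNN.mul {p r : Polynomial ℤ} (hp : CoeffNN p) (hr : CoeffNN r) :
    CoeffNN (p * r) := fun i => by
  rw [coeff_mul]; exact Finset.sum_nonneg fun x _ => mul_nonneg (hp _) (hr _)

theorem coeffNN_X_pow (k : ℕ) : CoeffNN (X ^ k) := fun i => by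
  rw [coeff_X_pow]; split_ifs <;> simp

theorem coeffNN_gauss : ∀ n m : ℕ, CoeffNN (gauss n m)
  | n, 0 => by
      intro i
      have : gauss n 0 = 1 := by cases n <;> simp [gauss]
      rw [this, coeff_one]; split_ifs <;> simp
  | 0, m + 1 => by intro i; simp [gauss]
  | n + 1, m + 1 => by
      rw [gauss]
      exact (coeffNN_gauss n m).add ((coeffNN_X_pow _).mul (coeffNN_gauss n (m + 1)))

theorem box_main : ∀ s a b c d k : ℕ, a + b + c + d = s → a ≤ c + 1 → d ≤ b + 1 →
    k + a + d ≤ b + c + 2 →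
    CoeffNN (boxG a b * boxG c d - X ^ k * (boxL a b * boxR c d)) := by
  intro s
  induction s using Nat.strong_induction_on with
  | _ s ih =>
  intro a b c d k hs hac hdb hk
  rcases a with _ | a
  · simp only [boxL, zero_mul, mul_zero, sub_zero]
    exact (coeffNN_gauss _ _).mul (coeffNN_gauss _ _)
  rcases d with _ | d
  · simp only [boxR, zero_mul, mul_zero, sub_zero]
    exact (coeffNN_gauss _ _).mul (coeffNN_gauss _ _)
  by_cases hc : a + 1 ≤ c
  · obtain ⟨c, rfl⟩ : ∃ c', c = c' + 1 := ⟨c - 1, by omega⟩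
    rcases k with _ | k
    · have h1 := ih _ (by omega) (a + 1) b c (d + 1) 0 rfl (by omega) (by omega) (by omega)
      have h2 := ih _ (by omega) (a + 1) b (c + 1) d 1 rfl (by omega) (by omega) (by omega)
      convert h1.add ((coeffNN_X_pow (c + 1)).mul h2) using 1
      rw [boxG_rec, boxR_rec]; ring
    · have h1 := ih _ (by omega) (a + 1) b (c + 1) d (k + 1) rfl (by omega) (by omega) (by omega)
      have h2 := ih _ (by omega) (a + 1) b c (d + 1) k rfl (by omega) (by omega) (by omega)
      convert h1.add ((coeffNN_X_pow (d + 1)).mul h2) using 1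
      rw [boxG_rec' c d, boxR_rec']; ring
  · obtain rfl : c = a := by omega
    by_cases hd : d + 1 ≤ b
    · obtain ⟨b, rfl⟩ : ∃ b', b = b' + 1 := ⟨b - 1, by omega⟩
      rcases k with _ | k
      · have h1 := ih _ (by omega) (c + 1) b c (d + 1) 0 rfl (by omega) (by omega) (by omega)
        have h2 := ih _ (by omega) c (b + 1) c (d + 1) 1 rfl (by omega) (by omega) (by omega)
        convert h1.add ((coeffNN_X_pow (b + 1)).mul h2) using 1
        rw [boxG_rec' c b, boxL_rec']; ring
      · have h1 := ih _ (by omega) c (b + 1) c (d + 1) (k + 1) rfl (by omega) (by omega) (by omega)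
        have h2 := ih _ (by omega) (c + 1) b c (d + 1) k rfl (by omega) (by omega) (by omega)
        convert h1.add ((coeffNN_X_pow (c + 1)).mul h2) using 1
        rw [boxG_rec c b, boxL_rec]; ring
    · obtain rfl : d = b := by omega
      obtain rfl : k = 0 := by omega
      intro i
      have : boxG (c + 1) d * boxG c (d + 1)
          - X ^ 0 * (boxL (c + 1) d * boxR c (d + 1)) = 0 := by
        simp only [boxL, boxR]; ring
      rw [this]; simp

/-- For `1 ≤ m ≤ l < N` and `M - m ≥ N - l ≥ 1`, the polynomial
`D_q(M,N,m,l) = [M m]_q·[N l]_q - [M m-1]_q·[N l+1]_q` has nonnegative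
coefficients. -/
theorem gauss_product_difference_nonneg (M N m l : ℕ)
    (hm : 1 ≤ m) (hml : m ≤ l) (hlN : l < N)
    (h1 : (1 : ℤ) ≤ (N : ℤ) - l) (h2 : (N : ℤ) - l ≤ (M : ℤ) - m) :
    ∀ i, 0 ≤ (gauss M m * gauss N l - gauss M (m - 1) * gauss N (l + 1)).coeff i := by
  obtain ⟨a, rfl⟩ : ∃ a, m = a + 1 := ⟨m - 1, by omega⟩
  obtain ⟨b, rfl⟩ : ∃ b, M = (a + 1) + b := ⟨M - (a + 1), by omega⟩
  obtain ⟨d, rfl⟩ : ∃ d, N = l + (d + 1) := ⟨N - l - 1, by omega⟩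
  have h := box_main _ (a + 1) b l (d + 1) 0 rfl (by omega) (by omega) (by omega)
  simp only [boxL, boxR, boxG, pow_zero, one_mul] at h
  have e1 : a + (b + 1) = a + 1 + b := by omega
  have e2 : l + 1 + d = l + (d + 1) := by omega
  rw [e1, e2] at h
  exact h
end

section
/- For all integers n ≥ m ≥ 1, Σ_{w ∈ ℳ(m−1, n−m)} q^{maj(w)} = Σ_{w ∈ ℳ̄₁(m, n−m+1)} q^{maj(w)}; that is, there is a major-index-preserving bijection between (0,1)-sequences of length n−1 with m−1 ones, and sequences in ℳ̄₁(m, n−m+1). -/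
open Polynomial Finset

def extW {N : ℕ} (w : Fin N → Bool) (i : ℕ) : Bool := if h : i < N then w ⟨i, h⟩ else true

lemma extW_fin {N : ℕ} (w : Fin N → Bool) (i : Fin N) : extW w i = w i := by
  simp [extW]

lemma extW_ge {N : ℕ} (w : Fin N → Bool) (i : ℕ) (h : N ≤ i) : extW w i = true := by
  simp [extW, h]

lemma extW_inj {N : ℕ} (w v : Fin N → Bool) (h : ∀ i, extW w i = extW v i) : w = v := by
  funext i
  rw [← extW_fin w, ← extW_fin v, h]

def IsT (f : ℕ → Bool) (s : ℕ) : Prop :=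
  (∀ i, s ≤ i → f i = true) ∧ (s = 0 ∨ f (s - 1) = false)

lemma IsT_unique {f : ℕ → Bool} {s t : ℕ} (hs : IsT f s) (ht : IsT f t) : s = t := by
  rcases hs with ⟨h1, h2⟩
  rcases ht with ⟨h3, h4⟩
  by_contra hne
  rcases Nat.lt_or_gt_of_ne hne with h | h
  · have := h1 (t - 1) (by omega)
    rcases h4 with h4 | h4
    · omega
    · simp [h4] at this
  · have := h3 (s - 1) (by omega)
    rcases h2 with h4 | h4
    · omega
    · simp [h4] at this

lemma exists_T {N : ℕ} (w : Fin N → Bool) : ∃ s, IsT (extW w) s := by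
  classical
  have hex : ∃ s, ∀ i, s ≤ i → extW w i = true := ⟨N, fun i hi => extW_ge w i hi⟩
  refine ⟨Nat.find hex, Nat.find_spec hex, ?_⟩
  by_contra! hc
  obtain ⟨h0, h1⟩ := hc
  refine Nat.find_min hex (m := Nat.find hex - 1) (by omega) ?_
  intro i hi
  by_cases h : i = Nat.find hex - 1
  · subst h
    simpa using h1
  · exact Nat.find_spec hex i (by omega)

noncomputable def TW {N : ℕ} (w : Fin N → Bool) : ℕ := (exists_T w).choose

lemma TW_spec {N : ℕ} (w : Fin N → Bool) : IsT (extW w) (TW w) := (exists_T w).choose_spec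

lemma TW_le {N : ℕ} (w : Fin N → Bool) : TW w ≤ N := by
  rcases (TW_spec w).2 with h | h
  · omega
  · by_contra hc
    rw [extW_ge w _ (by omega)] at h
    simp at h

noncomputable def gW {N : ℕ} (w : Fin N → Bool) : Fin (N + 2) → Bool :=
  fun i => if (i : ℕ) = TW w then false else extW w i

noncomputable def hW {N : ℕ} (v : Fin (N + 2) → Bool) : Fin N → Bool :=
  fun i => if (i : ℕ) + 1 < TW v then extW v i else true

lemma ext_gW {N : ℕ} (w : Fin N → Bool) (i : ℕ) :
    extW (gW w) i = if i = TW w then false else extW w i := by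
  have := TW_le w
  by_cases h : i < N + 2
  · exact extW_fin (gW w) ⟨i, h⟩
  · rw [extW_ge _ _ (by omega), if_neg (by omega), extW_ge _ _ (by omega)]

lemma ext_hW {N : ℕ} (v : Fin (N + 2) → Bool) (hv : TW v ≤ N + 1) (i : ℕ) :
    extW (hW v) i = if i + 1 < TW v then extW v i else true := by
  by_cases h : i < N
  · exact extW_fin (hW v) ⟨i, h⟩
  · rw [extW_ge _ _ (by omega), if_neg (by omega)]

lemma TW_gW {N : ℕ} (w : Fin N → Bool) : TW (gW w) = TW w + 1 := by
  refine IsT_unique (TW_spec _) ⟨?_, ?_⟩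
  · intro i hi
    rw [ext_gW, if_neg (by omega)]
    exact (TW_spec w).1 i (by omega)
  · right
    rw [ext_gW, if_pos (by omega)]

lemma hW_gW {N : ℕ} (w : Fin N → Bool) : hW (gW w) = w := by
  have hl := TW_le w
  apply extW_inj
  intro i
  rw [ext_hW _ (by rw [TW_gW]; omega), TW_gW, ext_gW]
  split_ifs with h1 h2
  · omega
  · rfl
  · exact ((TW_spec w).1 i (by omega)).symm

lemma gW_hW {N : ℕ} (v : Fin (N + 2) → Bool) (hv : TW v ≤ N + 1) (h1 : 1 ≤ TW v)
    (h2 : TW v = 1 ∨ extW v (TW v - 2) = false) : gW (hW v) = v := by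
  have hT : TW (hW v) = TW v - 1 := by
    refine IsT_unique (TW_spec _) ⟨?_, ?_⟩
    · intro i hi
      rw [ext_hW v hv, if_neg (by omega)]
    · by_cases h : TW v = 1
      · left; omega
      · right
        rw [ext_hW v hv, if_pos (by omega)]
        simpa [h, Nat.sub_sub] using h2
  apply extW_inj
  intro i
  rw [ext_gW, hT, ext_hW v hv]
  have hs := TW_spec v
  split_ifs with h3 h4
  · rcases hs.2 with h | h
    · omega
    · rw [h3, h]
  · rfl
  · exact (hs.1 i (by omega)).symm

lemma numOnes_eq {N : ℕ} (w : Fin N → Bool) :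
    numOnes w = ((Finset.range N).filter fun i => extW w i = true).card := by
  rw [numOnes, Finset.card_filter, Finset.card_filter,
    ← Fin.sum_univ_eq_sum_range (fun i => if extW w i = true then 1 else 0) N]
  simp only [extW_fin]

lemma majW_eq {N : ℕ} (w : Fin N → Bool) :
    majW w = ∑ i ∈ Finset.range N,
      if extW w i = true ∧ extW w (i + 1) = false then i + 1 else 0 := by
  rw [majW, ← Fin.sum_univ_eq_sum_range
    (fun i => if extW w i = true ∧ extW w (i + 1) = false then i + 1 else 0) N]
  refine Finset.sum_congr rfl fun i _ => ?_
  rw [extW_fin]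
  by_cases h : (i : ℕ) + 1 < N
  · simp [h, extW]
  · simp [h, extW]

lemma numOnes_gW {N : ℕ} (w : Fin N → Bool) : numOnes (gW w) = numOnes w + 1 := by
  rw [numOnes_eq, numOnes_eq]
  have hl := TW_le w
  have hT := (TW_spec w).1 (TW w) le_rfl
  have : ((Finset.range (N + 2)).filter fun i => extW (gW w) i = true) =
      ((Finset.range (N + 2)).filter fun i => extW w i = true).erase (TW w) := by
    ext i
    simp only [Finset.mem_filter, Finset.mem_erase, ext_gW]
    by_cases h : i = TW w <;> simp [h]
  rw [this, Finset.card_erase_of_mem (by simp [hT]; omega), Finset.range_add_one,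
    Finset.range_add_one, Finset.filter_insert, Finset.filter_insert,
    if_pos (extW_ge _ _ (by omega)), if_pos (extW_ge _ _ (by omega)),
    Finset.card_insert_of_notMem (by simp), Finset.card_insert_of_notMem (by simp)]
  omega

lemma majW_gW {N : ℕ} (w : Fin N → Bool) : majW (gW w) = majW w := by
  rw [majW_eq, majW_eq]
  have hs := TW_spec w
  have h1 : ∀ i, (extW (gW w) i = true ∧ extW (gW w) (i + 1) = false) ↔
      (extW w i = true ∧ extW w (i + 1) = false) := by
    intro i
    rw [ext_gW, ext_gW]
    by_cases h : i = TW w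
    · have := hs.1 (i + 1) (by omega)
      simp [h] at *
      simp [this]
    · by_cases h' : i + 1 = TW w
      · have h3 : extW w i = false := by
          rcases hs.2 with h4 | h4
          · omega
          · rw [← h4]; congr 1; omega
        simp [h3]
      · simp [h, h']
  simp only [h1]
  rw [Finset.sum_range_succ, Finset.sum_range_succ, extW_ge w (N + 1) (by omega),
    extW_ge w (N + 1 + 1) (by omega)]
  simp

/-- For `n ≥ m ≥ 1`, the major index is equidistributed over the
set `ℳ(m-1, n-m)` of (0,1)-sequences of length `n-1` with `m-1` ones, and the set
`ℳ̄₁(m, n-m+1)` of (0,1)-sequences of length `n+1` with `m` ones whose last entry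
is `1` and such that if `t` is the (1-based) position of the last zero then `t = 1`
or `w_(t-1) = 0`.  (Below positions are 0-based, so the condition reads: for the
maximal position `t` with `w t = 0`, either `t = 0` or `w (t-1) = 0`.) -/
theorem maj_equidistributed_M_M1bar (n m : ℕ) (hm : 1 ≤ m) (hmn : m ≤ n) :
    (∑ w ∈ (Finset.univ : Finset (Fin (n - 1) → Bool)).filter
        (fun w => numOnes w = m - 1),
      (X : Polynomial ℤ) ^ majW w) =
    (∑ w ∈ (Finset.univ : Finset (Fin (n + 1) → Bool)).filter
        (fun w => numOnes w = m ∧ w (Fin.last n) = true ∧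
          (∀ t : Fin (n + 1), w t = false →
            (∀ j : Fin (n + 1), t < j → w j = true) →
              ((t : ℕ) = 0 ∨
                w ⟨(t : ℕ) - 1, lt_of_le_of_lt (Nat.sub_le _ _) t.isLt⟩ = false))),
      X ^ majW w) := by
  obtain ⟨N, rfl⟩ : ∃ N, n = N + 1 := ⟨n - 1, by omega⟩
  change (∑ w ∈ (Finset.univ : Finset (Fin N → Bool)).filter
        (fun w => numOnes w = m - 1), (X : Polynomial ℤ) ^ majW w) = _
  have key : ∀ v : Fin (N + 2) → Bool, (numOnes v = m ∧ v (Fin.last (N + 1)) = true ∧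
          (∀ t : Fin (N + 1 + 1), v t = false →
            (∀ j : Fin (N + 1 + 1), t < j → v j = true) →
              ((t : ℕ) = 0 ∨
                v ⟨(t : ℕ) - 1, lt_of_le_of_lt (Nat.sub_le _ _) t.isLt⟩ = false))) →
          gW (hW v) = v := by
    rintro v ⟨h1, h2, h3⟩
    have hs := TW_spec v
    have hle := TW_le v
    have hpos : 1 ≤ TW v := by
      by_contra hc
      have : numOnes v = N + 2 := by
        rw [numOnes_eq, Finset.filter_true_of_mem, Finset.card_range]
        intro i _
        exact hs.1 i (by omega)
      omega
    have hf : extW v (TW v - 1) = false := by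
      rcases hs.2 with h | h
      · omega
      · exact h
    have hl : extW v (N + 1) = true := by
      rw [← h2]; exact extW_fin v (Fin.last (N + 1))
    have hle' : TW v ≤ N + 1 := by
      by_contra hc
      have : TW v - 1 = N + 1 := by omega
      rw [this, hl] at hf
      simp at hf
    refine gW_hW v hle' hpos ?_
    have h4 := h3 ⟨TW v - 1, by omega⟩ (by rw [← extW_fin v]; exact hf) (by
      intro j hj
      rw [← extW_fin v]
      have : TW v - 1 < (j : ℕ) := hj
      exact hs.1 j (by omega))
    rcases h4 with h4 | h4
    · left
      simp only at h4
      omega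
    · right
      rw [← extW_fin v] at h4
      rw [← h4]
      rfl
  refine Finset.sum_bij' (fun w _ => gW w) (fun v _ => hW v) ?_ ?_ ?_ ?_ ?_
  · intro w hw
    rw [Finset.mem_filter] at hw ⊢
    have hle := TW_le w
    have hs := TW_spec w
    have hg := TW_spec (gW w)
    rw [TW_gW] at hg
    refine ⟨Finset.mem_univ _, ?_, ?_, ?_⟩
    · rw [numOnes_gW]; omega
    · rw [← extW_fin (gW w)]
      exact hg.1 _ (by simp; omega)
    · intro t ht htj
      have hT : (t : ℕ) + 1 = TW w + 1 := by
        refine IsT_unique (f := extW (gW w)) ⟨?_, ?_⟩ hg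
        · intro i hi
          by_cases hi2 : i < N + 2
          · exact (extW_fin (gW w) ⟨i, hi2⟩).trans (htj ⟨i, hi2⟩ (by
              rw [Fin.lt_def]; simp only; omega))
          · exact extW_ge _ _ (by omega)
        · right
          simpa [extW_fin] using ht
      rcases hs.2 with h | h
      · left; omega
      · by_cases h0 : (t : ℕ) = 0
        · left; exact h0
        · right
          rw [← extW_fin (gW w), ext_gW, if_neg (by simp only; omega), ← h]
          congr 1
          simp only
          omega
  · intro v hv
    rw [Finset.mem_filter] at hv ⊢
    refine ⟨Finset.mem_univ _, ?_⟩
    have h1 := numOnes_gW (hW v)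
    rw [key v hv.2, hv.2.1] at h1
    omega
  · intro w _
    exact hW_gW w
  · intro v hv
    exact key v (Finset.mem_filter.mp hv).2
  · intro w _
    simp only [majW_gW]
end
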